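/- Let A ∈ ℝ^{pn×pn} be a symmetric positive definite weakly admissible BLR² matrix with p blocks of size n, skeleton width r ≤ n, shared bases U_0,…,U_{p−1} and skeleton blocks S_{ij}. With Â = (U^F)ᵀ A U^F, Â_{ii}^{RR}, Â_{ii}^{SR}, Â_{ii}^{SS} the blocks of its diagonal blocks, define the merged matrix M ∈ ℝ^{pr×pr} in p×p block form by M_{ii} = Â_{ii}^{SS} − Â_{ii}^{SR} (Â_{ii}^{RR})⁻¹ (Â_{ii}^{SR})ᵀ and M_{ij} = S_{ij} for i ≠ j. Then each Â_{ii}^{RR} is positive definite (hence invertible) and M is symmetric positive definite. -/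

import Mathlib

open Matrix

/-- The skeleton part `U^S` of a basis matrix: the last `r` columns, when the columns are
indexed by `Fin q ⊕ Fin r` (`q = n - r` redundant columns followed by `r` skeleton columns). -/
def skelCols {α : Type*} {q r : ℕ} (U : Matrix α (Fin q ⊕ Fin r) ℝ) : Matrix α (Fin r) ℝ :=
  U.submatrix id Sum.inr

/-- The `(i, j)` block (of size `n × n`, `n = q + r`) of a `p × p` block matrix whose global
index type is `(Fin q ⊕ Fin r) × Fin p` (within-block index first, block index second,
matching `Matrix.blockDiagonal`). -/
def blk {q r p : ℕ}
    (A : Matrix ((Fin q ⊕ Fin r) × Fin p) ((Fin q ⊕ Fin r) × Fin p) ℝ) (i j : Fin p) :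
    Matrix (Fin q ⊕ Fin r) (Fin q ⊕ Fin r) ℝ :=
  Matrix.of fun a b => A (a, i) (b, j)

/-- Blocks of a congruence by block diagonal matrices. -/
theorem blockDiagonal_transpose_mul_mul_apply {α β p : Type*} [Fintype α] [Fintype p]
    [DecidableEq p] (V : p → Matrix α β ℝ) (A : Matrix (α × p) (α × p) ℝ) (a b : β) (i j : p) :
    ((blockDiagonal V)ᵀ * A * blockDiagonal V) (a, i) (b, j) =
      ((V i)ᵀ * Matrix.of (fun x y => A (x, i) (y, j)) * V j) a b := by
  simp [Matrix.mul_apply, Fintype.sum_prod_type, blockDiagonal_apply, ite_mul, mul_ite]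

/-- A block diagonal matrix whose blocks have left inverses acts injectively. -/
theorem mulVec_blockDiagonal_injective {α β p : Type*} [Fintype α] [Fintype β] [Fintype p]
    [DecidableEq β] [DecidableEq p] (V : p → Matrix α β ℝ) (L : p → Matrix β α ℝ)
    (h : ∀ i, L i * V i = 1) : Function.Injective (blockDiagonal V).mulVec := by
  have hL : blockDiagonal L * blockDiagonal V = 1 := by
    rw [← blockDiagonal_mul, funext h]
    exact blockDiagonal_one
  intro x y hxy
  simpa [mulVec_mulVec, hL] using congrArg (blockDiagonal L).mulVec hxy

/-- Eliminating the redundant variables of a symmetric block matrix leaves its Schur complement. -/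
theorem schur_congruence {m n : Type*} [Fintype m] [Fintype n] [DecidableEq m] [DecidableEq n]
    (H : Matrix (m ⊕ n) (m ⊕ n) ℝ) (hH : Hᵀ = H) (hR : IsUnit H.toBlocks₁₁) :
    (fromRows (-(H.toBlocks₁₁⁻¹ * H.toBlocks₂₁ᵀ)) (1 : Matrix n n ℝ))ᵀ * H *
        fromRows (-(H.toBlocks₁₁⁻¹ * H.toBlocks₂₁ᵀ)) (1 : Matrix n n ℝ) =
      H.toBlocks₂₂ - H.toBlocks₂₁ * H.toBlocks₁₁⁻¹ * H.toBlocks₂₁ᵀ := by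
  have h12 : H.toBlocks₁₂ = H.toBlocks₂₁ᵀ := by
    ext a b
    exact (congrFun (congrFun hH (Sum.inl a)) (Sum.inr b)).symm
  have hdet := (Matrix.isUnit_iff_isUnit_det _).mp hR
  have hW : H * fromRows (-(H.toBlocks₁₁⁻¹ * H.toBlocks₂₁ᵀ)) (1 : Matrix n n ℝ) =
      fromRows 0 (H.toBlocks₂₂ - H.toBlocks₂₁ * H.toBlocks₁₁⁻¹ * H.toBlocks₂₁ᵀ) := by
    conv_lhs => lhs; rw [← fromBlocks_toBlocks H]
    rw [fromBlocks_mul_fromRows, h12]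
    simp [Matrix.mul_assoc, Matrix.mul_nonsing_inv_cancel_left _ _ hdet, sub_eq_neg_add]
  rw [Matrix.mul_assoc, hW, transpose_fromRows, fromCols_mul_fromRows]
  simp

theorem transpose_mul_skelCols {q r : ℕ} (U : Matrix (Fin q ⊕ Fin r) (Fin q ⊕ Fin r) ℝ)
    (hU : Uᵀ * U = 1) : Uᵀ * skelCols U = fromRows 0 1 := by
  have h : Uᵀ * skelCols U = (Uᵀ * U).submatrix id Sum.inr := rfl
  rw [h, hU]
  ext (a | a) b <;> simp [Matrix.one_apply]

/-- Correctness of the merge step.  Let `A` be a symmetric positive definite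
weakly admissible BLR² matrix with `p` blocks of size `n = q + r`, skeleton width `r`, shared
orthogonal bases `U i` and skeleton blocks `S i j`, and let `Â = (U^F)ᵀ A U^F`.  Define the
merged `pr × pr` matrix `M` blockwise by
`M_{ii} = Â_{ii}^{SS} - Â_{ii}^{SR} (Â_{ii}^{RR})⁻¹ (Â_{ii}^{SR})ᵀ` and `M_{ij} = S i j` for
`i ≠ j`.  Then each `Â_{ii}^{RR}` is positive definite (hence invertible), and `M` is symmetric
positive definite. -/
theorem blr2_merge_posdef {q r p : ℕ}
    (U : Fin p → Matrix (Fin q ⊕ Fin r) (Fin q ⊕ Fin r) ℝ)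
    (hU : ∀ i, (U i)ᵀ * U i = 1)
    (S : Fin p → Fin p → Matrix (Fin r) (Fin r) ℝ)
    (A : Matrix ((Fin q ⊕ Fin r) × Fin p) ((Fin q ⊕ Fin r) × Fin p) ℝ)
    (hsym : Aᵀ = A) (hpd : A.PosDef)
    (hblr : ∀ i j, i ≠ j → blk A i j = skelCols (U i) * S i j * (skelCols (U j))ᵀ)
    (Ahat : Matrix ((Fin q ⊕ Fin r) × Fin p) ((Fin q ⊕ Fin r) × Fin p) ℝ)
    (hAhat : Ahat = (Matrix.blockDiagonal U)ᵀ * A * Matrix.blockDiagonal U)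
    (M : Matrix (Fin r × Fin p) (Fin r × Fin p) ℝ)
    (hM : ∀ (a b : Fin r) (i j : Fin p), M (a, i) (b, j) =
      if i = j then
        ((blk Ahat i i).toBlocks₂₂ -
          (blk Ahat i i).toBlocks₂₁ * ((blk Ahat i i).toBlocks₁₁)⁻¹ *
            ((blk Ahat i i).toBlocks₂₁)ᵀ) a b
      else S i j a b) :
    (∀ i, ((blk Ahat i i).toBlocks₁₁).PosDef) ∧ Mᵀ = M ∧ M.PosDef := by
  have hAhatpd : Ahat.PosDef := by
    rw [hAhat, ← conjTranspose_eq_transpose_of_trivial]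
    exact hpd.conjTranspose_mul_mul_same (mulVec_blockDiagonal_injective U (fun i => (U i)ᵀ) hU)
  have hblk : ∀ i j, blk Ahat i j = (U i)ᵀ * blk A i j * U j := by
    intro i j
    ext a b
    simp only [blk, of_apply, hAhat]
    exact blockDiagonal_transpose_mul_mul_apply U A a b i j
  have hRR : ∀ i, ((blk Ahat i i).toBlocks₁₁).PosDef := fun i =>
    hAhatpd.submatrix (e := fun a : Fin q => ((Sum.inl a : Fin q ⊕ Fin r), i))
      (fun a b h => by simpa using h)
  have hsymm : ∀ i, (blk Ahat i i)ᵀ = blk Ahat i i := by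
    intro i
    ext a b
    simpa [blk] using hAhatpd.isHermitian.apply (a, i) (b, i)
  let W : Fin p → Matrix (Fin q ⊕ Fin r) (Fin r) ℝ := fun i =>
    fromRows (-((blk Ahat i i).toBlocks₁₁⁻¹ * (blk Ahat i i).toBlocks₂₁ᵀ)) 1
  have hMW : M = (blockDiagonal W)ᵀ * Ahat * blockDiagonal W := by
    ext ⟨a, i⟩ ⟨b, j⟩
    rw [hM, blockDiagonal_transpose_mul_mul_apply]
    change _ = ((W i)ᵀ * blk Ahat i j * W j) a b
    split_ifs with hij
    · subst hij
      rw [schur_congruence _ (hsymm i) (hRR i).isUnit]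
    · have hleft : ∀ k, (W k)ᵀ * ((U k)ᵀ * skelCols (U k)) = 1 := fun k => by
        simp [W, transpose_mul_skelCols _ (hU k), transpose_fromRows, fromCols_mul_fromRows]
      have hright : (skelCols (U j))ᵀ * (U j * W j) = 1 := by
        simpa [Matrix.mul_assoc] using congrArg transpose (hleft j)
      have hS : (W i)ᵀ * blk Ahat i j * W j =
          ((W i)ᵀ * ((U i)ᵀ * skelCols (U i))) * S i j *
            ((skelCols (U j))ᵀ * (U j * W j)) := by
        rw [hblk, hblr i j hij]
        simp only [Matrix.mul_assoc]
      rw [hS, hleft, hright, Matrix.one_mul, Matrix.mul_one]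
  have hMpd : M.PosDef := by
    rw [hMW, ← conjTranspose_eq_transpose_of_trivial]
    refine hAhatpd.conjTranspose_mul_mul_same
      (mulVec_blockDiagonal_injective W (fun _ => fromCols 0 1) fun i => ?_)
    simp [W, fromCols_mul_fromRows]
  refine ⟨hRR, ?_, hMpd⟩
  rw [← conjTranspose_eq_transpose_of_trivial]
  exact hMpd.isHermitian
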